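/- 2-dipole contraction preserves the topology of a bubble: Let (σ_1, σ_2, σ_3) be a connected bubble on 2n vertices with n ≥ 2, and suppose there is a white vertex v and two distinct colors c_1 ≠ c_2 in {1,2,3} with σ_{c_1} v = σ_{c_2} v =: v̄ and σ_{c_3} v ≠ v̄, where c_3 is the third color. Define the contracted bubble B' on 2(n−1) vertices with white set Fin n ∖ {v} and black set Fin n ∖ {v̄} by: σ'_{c_1} and σ'_{c_2} are the restrictions of σ_{c_1} and σ_{c_2} (which map v to v̄), and σ'_{c_3} x = σ_{c_3} x if σ_{c_3} x ≠ v̄ and σ'_{c_3} x = σ_{c_3} v if σ_{c_3} x = v̄. Then B' is a connected bubble and its Euler deficiency equals that of B: (n + 2) − (C_{12}(B) + C_{13}(B) + C_{23}(B)) = ((n−1) + 2) − (C_{12}(B') + C_{13}(B') + C_{23}(B')); in particular B is planar if and only if B' is planar. -/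

import Mathlib

/-- The setoid on `α` whose classes are the cycles (orbits) of the permutation `π`. -/
def permSetoid {α : Type*} (π : Equiv.Perm α) : Setoid α :=
  ⟨π.SameCycle, ⟨fun _ => ⟨0, by simp⟩, fun h => h.symm, fun h h' => h.trans h'⟩⟩

/-- The number of cycles (orbits) of a permutation. -/
noncomputable def numCycles {α : Type*} (π : Equiv.Perm α) : ℕ :=
  Nat.card (Quotient (permSetoid π))

/-- Connectivity of the bubble `(σ 0, σ 1, σ 2)` with three colors. -/
def BubbleConnected {n : ℕ} (σ : Fin 3 → Equiv.Perm (Fin n)) : Prop :=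
  ∀ x y : Fin n,
    ∃ g ∈ Subgroup.closure {g : Equiv.Perm (Fin n) | ∃ a b : Fin 3, g = (σ a)⁻¹ * σ b},
      g x = y

theorem dip_ais {α : Type*} (f : Equiv.Perm α) (x : α) : f (f⁻¹ x) = x :=
  Equiv.apply_symm_apply f x

theorem dip_inv {α β : Type*} [DecidableEq α] (π : Equiv.Perm α) (v : α)
    (π' : Equiv.Perm {x : α // x ≠ v})
    (h : ∀ x : {x : α // x ≠ v}, (π' x : α) = if π x = v then π v else π x)
    (F : α → β) (hF : ∀ x : {x : α // x ≠ v}, F (π' x) = F x) (hv : F (π v) = F v) (x : α) :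
    F (π x) = F x := by
  by_cases hx : x = v
  · subst hx; exact hv
  · have h1 := h ⟨x, hx⟩
    have h2 := hF ⟨x, hx⟩
    rw [h1] at h2
    simp only at h2
    split_ifs at h2 with h3
    · rw [h3, ← hv, h2]
    · exact h2

theorem dip_zpow {α β : Type*} (π : Equiv.Perm α) (F : α → β) (hF : ∀ x, F (π x) = F x)
    {x y : α} (h : π.SameCycle x y) : F x = F y := by
  obtain ⟨k, rfl⟩ := h
  have hF' : ∀ x, F (π⁻¹ x) = F x := fun x => by
    have := hF (π⁻¹ x)
    rw [dip_ais] at this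
    exact this.symm
  induction k with
  | zero => simp
  | succ i ih => rw [add_comm, zpow_add, zpow_one, Equiv.Perm.mul_apply, hF, ih]
  | pred i ih =>
    rw [sub_eq_add_neg, add_comm, zpow_add, zpow_neg_one, Equiv.Perm.mul_apply, hF', ih]

theorem dip_up {α : Type*} [DecidableEq α] (π : Equiv.Perm α) (v : α)
    (π' : Equiv.Perm {x : α // x ≠ v})
    (h : ∀ x : {x : α // x ≠ v}, (π' x : α) = if π x = v then π v else π x)
    {x y : {x : α // x ≠ v}} (hxy : π'.SameCycle x y) : π.SameCycle x y := by
  have := dip_zpow π' (fun z => (Quotient.mk (permSetoid π) (z : α))) (fun z => by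
    apply Quotient.sound
    change π.SameCycle _ _
    rw [h]
    split_ifs with h3
    · apply Equiv.Perm.sameCycle_apply_left.2
      have h4 : π.SameCycle (π z) z :=
        Equiv.Perm.sameCycle_apply_left.2 (Equiv.Perm.SameCycle.refl _ _)
      rwa [h3] at h4
    · exact (Equiv.Perm.sameCycle_apply_left.2 (Equiv.Perm.SameCycle.refl _ _))) hxy
  exact Quotient.exact this

theorem dip_mk {α : Type*} (π : Equiv.Perm α) (x : α) :
    Quotient.mk (permSetoid π) (π x) = Quotient.mk (permSetoid π) x :=
  Quotient.sound (Equiv.Perm.sameCycle_apply_left.2 (Equiv.Perm.SameCycle.refl _ _))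

theorem dip_count_ne {α : Type*} [DecidableEq α] (π : Equiv.Perm α) (v : α)
    (π' : Equiv.Perm {x : α // x ≠ v})
    (h : ∀ x : {x : α // x ≠ v}, (π' x : α) = if π x = v then π v else π x)
    (hv : π v ≠ v) : numCycles π = numCycles π' := by
  unfold numCycles
  let F : α → Quotient (permSetoid π') := fun x =>
    if hx : x = v then Quotient.mk _ ⟨π v, hv⟩ else Quotient.mk _ ⟨x, hx⟩
  have Fne : ∀ x : {x : α // x ≠ v}, F x = Quotient.mk _ x := fun x => by
    simp [F, x.2]
  have hF : ∀ x, F (π x) = F x := dip_inv π v π' h F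
    (fun x => by rw [Fne, Fne, dip_mk]) (by simp [F, hv])
  refine Nat.card_congr
    { toFun := Quotient.lift F (fun x y hxy => dip_zpow π F hF hxy)
      invFun := Quotient.lift (fun x => Quotient.mk _ (x : α))
        (fun x y hxy => Quotient.sound (dip_up π v π' h hxy))
      left_inv := ?_
      right_inv := ?_ }
  · rintro ⟨x⟩
    change Quotient.lift _ _ (F x) = Quotient.mk _ x
    by_cases hx : x = v
    · subst hx
      simp only [F, dite_true]
      exact dip_mk _ _
    · simp only [F, hx, dite_false]
      rfl
  · rintro ⟨x⟩
    exact Fne x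

theorem dip_count_eq {α : Type*} [Finite α] [DecidableEq α] (π : Equiv.Perm α) (v : α)
    (π' : Equiv.Perm {x : α // x ≠ v})
    (h : ∀ x : {x : α // x ≠ v}, (π' x : α) = if π x = v then π v else π x)
    (hv : π v = v) : numCycles π = numCycles π' + 1 := by
  unfold numCycles
  rw [← Finite.card_option]
  let F : α → Option (Quotient (permSetoid π')) := fun x =>
    if hx : x = v then none else some (Quotient.mk _ ⟨x, hx⟩)
  have Fne : ∀ x : {x : α // x ≠ v}, F x = some (Quotient.mk _ x) := fun x => by
    simp [F, x.2]
  have hF : ∀ x, F (π x) = F x := dip_inv π v π' h F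
    (fun x => by rw [Fne, Fne, dip_mk]) (by rw [hv])
  refine Nat.card_congr
    { toFun := Quotient.lift F (fun x y hxy => dip_zpow π F hF hxy)
      invFun := fun o => o.elim (Quotient.mk _ v) (Quotient.lift (fun x => Quotient.mk _ (x : α))
        (fun x y hxy => Quotient.sound (dip_up π v π' h hxy)))
      left_inv := ?_
      right_inv := ?_ }
  · rintro ⟨x⟩
    change Option.elim (F x) _ _ = Quotient.mk _ x
    by_cases hx : x = v
    · subst hx
      simp only [F, dite_true]
      rfl
    · simp only [F, hx, dite_false]
      rfl
  · rintro (_ | ⟨⟨x⟩⟩)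
    · change F v = none
      simp [F]
    · exact Fne x

/-- **2-dipole contraction preserves the topology of a bubble**: let `(σ c₁, σ c₂, σ c₃)` be a
connected bubble on `2n` vertices with a 2-dipole `σ c₁ v = σ c₂ v = vb`, `σ c₃ v ≠ vb`.
The contracted bubble `B'` on white set `{x ≠ v}` and black set `{y ≠ vb}` — given by equivs
`e a` restricting `σ c₁, σ c₂` and redirecting `σ c₃` through the contracted pair — is a
connected bubble with the same Euler deficiency as `B`; in particular `B` is planar iff `B'`
is planar. -/
theorem two_dipole_contraction {n : ℕ} (hn : 2 ≤ n)
    (σ : Fin 3 → Equiv.Perm (Fin n)) (hconn : BubbleConnected σ)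
    (c₁ c₂ c₃ : Fin 3) (h12 : c₁ ≠ c₂) (h13 : c₁ ≠ c₃) (h23 : c₂ ≠ c₃)
    (v vb : Fin n) (hv1 : σ c₁ v = vb) (hv2 : σ c₂ v = vb) (hv3 : σ c₃ v ≠ vb)
    (e : Fin 3 → ({x : Fin n // x ≠ v} ≃ {y : Fin n // y ≠ vb}))
    (he1 : ∀ x : {x : Fin n // x ≠ v}, (e c₁ x : Fin n) = σ c₁ (x : Fin n))
    (he2 : ∀ x : {x : Fin n // x ≠ v}, (e c₂ x : Fin n) = σ c₂ (x : Fin n))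
    (he3 : ∀ x : {x : Fin n // x ≠ v}, (e c₃ x : Fin n) =
      if σ c₃ (x : Fin n) = vb then σ c₃ v else σ c₃ (x : Fin n)) :
    (∀ x y : {x : Fin n // x ≠ v},
      ∃ g ∈ Subgroup.closure {g : Equiv.Perm {x : Fin n // x ≠ v} |
        ∃ a b : Fin 3, g = (e b).trans (e a).symm}, g x = y) ∧
    ((n : ℤ) + 2) - (numCycles ((σ c₁)⁻¹ * σ c₂) + numCycles ((σ c₁)⁻¹ * σ c₃) +
        numCycles ((σ c₂)⁻¹ * σ c₃) : ℕ) =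
      (((n : ℤ) - 1) + 2) - (numCycles ((e c₂).trans (e c₁).symm) +
        numCycles ((e c₃).trans (e c₁).symm) + numCycles ((e c₃).trans (e c₂).symm) : ℕ) ∧
    (numCycles ((σ c₁)⁻¹ * σ c₂) + numCycles ((σ c₁)⁻¹ * σ c₃) +
        numCycles ((σ c₂)⁻¹ * σ c₃) = n + 2 ↔
      numCycles ((e c₂).trans (e c₁).symm) + numCycles ((e c₃).trans (e c₁).symm) +
        numCycles ((e c₃).trans (e c₂).symm) = (n - 1) + 2) := by
  have hπ : ∀ c : Fin 3, σ c v = vb →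
      (∀ x : {x : Fin n // x ≠ v}, (e c x : Fin n) = σ c (x : Fin n)) →
      ∀ y : {y : Fin n // y ≠ vb}, (((e c).symm y : {x : Fin n // x ≠ v}) : Fin n)
        = (σ c)⁻¹ (y : Fin n) := by
    intro c _ hc y
    rw [Equiv.Perm.eq_inv_iff_eq, ← hc, Equiv.apply_symm_apply]
  have hi1 : (σ c₁)⁻¹ vb = v := by rw [Equiv.Perm.inv_eq_iff_eq, hv1]
  have hi2 : (σ c₂)⁻¹ vb = v := by rw [Equiv.Perm.inv_eq_iff_eq, hv2]
  have hj1 : ∀ y, (σ c₁)⁻¹ y = v ↔ y = vb := fun y => by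
    rw [Equiv.Perm.inv_eq_iff_eq, hv1]
  have hj2 : ∀ y, (σ c₂)⁻¹ y = v ↔ y = vb := fun y => by
    rw [Equiv.Perm.inv_eq_iff_eq, hv2]
  have k12 : ∀ x : {x : Fin n // x ≠ v}, ((((e c₂).trans (e c₁).symm) x :
      {x : Fin n // x ≠ v}) : Fin n) = if ((σ c₁)⁻¹ * σ c₂) x = v then ((σ c₁)⁻¹ * σ c₂) v
        else ((σ c₁)⁻¹ * σ c₂) x := by
    intro x
    have hx : σ c₂ x ≠ vb := fun hh => x.2 ((σ c₂).injective (hh.trans hv2.symm))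
    simp only [Equiv.trans_apply, Equiv.Perm.mul_apply, hπ c₁ hv1 he1, he2, hj1, hx, if_false]
  have k13 : ∀ x : {x : Fin n // x ≠ v}, ((((e c₃).trans (e c₁).symm) x :
      {x : Fin n // x ≠ v}) : Fin n) = if ((σ c₁)⁻¹ * σ c₃) x = v then ((σ c₁)⁻¹ * σ c₃) v
        else ((σ c₁)⁻¹ * σ c₃) x := by
    intro x
    simp only [Equiv.trans_apply, Equiv.Perm.mul_apply, hπ c₁ hv1 he1, he3, hj1]
    split_ifs <;> rfl
  have k23 : ∀ x : {x : Fin n // x ≠ v}, ((((e c₃).trans (e c₂).symm) x :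
      {x : Fin n // x ≠ v}) : Fin n) = if ((σ c₂)⁻¹ * σ c₃) x = v then ((σ c₂)⁻¹ * σ c₃) v
        else ((σ c₂)⁻¹ * σ c₃) x := by
    intro x
    simp only [Equiv.trans_apply, Equiv.Perm.mul_apply, hπ c₂ hv2 he2, he3, hj2]
    split_ifs <;> rfl
  have f12 : ((σ c₁)⁻¹ * σ c₂) v = v := by rw [Equiv.Perm.mul_apply, hv2, hi1]
  have f13 : ((σ c₁)⁻¹ * σ c₃) v ≠ v := by rw [Equiv.Perm.mul_apply, Ne, hj1]; exact hv3
  have f23 : ((σ c₂)⁻¹ * σ c₃) v ≠ v := by rw [Equiv.Perm.mul_apply, Ne, hj2]; exact hv3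
  have n12 := dip_count_eq _ v _ k12 f12
  have n13 := dip_count_ne _ v _ k13 f13
  have n23 := dip_count_ne _ v _ k23 f23
  refine ⟨?_, ?_, ?_⟩
  · let G := Subgroup.closure {g : Equiv.Perm {x : Fin n // x ≠ v} |
        ∃ a b : Fin 3, g = (e b).trans (e a).symm}
    let Q := MulAction.orbitRel.Quotient G {x : Fin n // x ≠ v}
    let mk : {x : Fin n // x ≠ v} → Q := fun x => Quotient.mk _ x
    let F : Fin n → Q := fun x =>
      if hx : x = v then mk ⟨_, f13⟩ else mk ⟨x, hx⟩
    have Fne : ∀ x : {x : Fin n // x ≠ v}, F x = mk x := fun x => by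
      simp [F, x.2]
    have hG : ∀ (a b : Fin 3) (x : {x : Fin n // x ≠ v}),
        mk (((e b).trans (e a).symm) x) = mk x := by
      intro a b x
      apply Quotient.sound
      exact ⟨⟨_, Subgroup.subset_closure ⟨a, b, rfl⟩⟩, rfl⟩
    have i1 : ∀ x, F (((σ c₁)⁻¹ * σ c₁) x) = F x := fun x => by simp
    have i2 : ∀ x, F (((σ c₁)⁻¹ * σ c₂) x) = F x := dip_inv _ v _ k12 F
      (fun x => by rw [Fne, Fne, hG]) (by rw [f12])
    have i3 : ∀ x, F (((σ c₁)⁻¹ * σ c₃) x) = F x := dip_inv _ v _ k13 F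
      (fun x => by rw [Fne, Fne, hG]) (by
        rw [Fne ⟨_, f13⟩]; simp [F])
    have ic : ∀ c x, F ((σ c₁)⁻¹ (σ c x)) = F x := by
      intro c x
      have : c = c₁ ∨ c = c₂ ∨ c = c₃ := by omega
      rcases this with rfl | rfl | rfl
      · exact i1 x
      · exact i2 x
      · exact i3 x
    have iab : ∀ a b x, F (((σ a)⁻¹ * σ b) x) = F x := by
      intro a b x
      rw [← ic a, Equiv.Perm.mul_apply, dip_ais, ic]
    intro x y
    obtain ⟨g, hg, hgx⟩ := hconn y x
    have key : ∀ z, F (g z) = F z := by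
      clear hgx
      induction hg using Subgroup.closure_induction with
      | mem g hg => obtain ⟨a, b, rfl⟩ := hg; exact iab a b
      | one => intro z; rfl
      | mul g h _ _ ihg ihh => intro z; rw [Equiv.Perm.mul_apply, ihg, ihh]
      | inv g _ ih =>
        intro z
        rw [← ih, dip_ais]
    have h1 := key y
    rw [hgx, Fne, Fne] at h1
    obtain ⟨k, hk⟩ := Quotient.exact h1.symm
    exact ⟨k, k.2, hk⟩
  · rw [n12, n13, n23]; push_cast; ring
  · rw [n12, n13, n23]; omega
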